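/- arXiv:2403.19701 — 4 statements merged into one kernel-verified Lean document; each statement's English description precedes it below -/
import Mathlib

section
/- Let m ≥ 1 be an integer. For all integers n ≥ m, ∑_{j=0}^{n-m-1} F^{(m)}(j) · (F^{(m+2)}(n-m-j) + F^{(m+2)}(n-m-j-1)) = F^{(m+2)}(n) − F^{(m)}(n). -/
/-- Fibonacci `m`-step numbers: `fibm m 0 = 0`, `fibm m 1 = 1`, and for `n ≥ 2`,
`fibm m n = ∑_{j=1}^{m} fibm m (n - j)`, negative indices counting as `0`
(equivalently via truncated subtraction, since `fibm m 0 = 0`). -/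
def fibm (m : ℕ) : ℕ → ℤ
  | 0 => 0
  | 1 => 1
  | n + 2 => ∑ j ∈ Finset.range m, fibm m (n + 1 - j)
decreasing_by exact Nat.lt_succ_of_le (Nat.sub_le _ _)

open PowerSeries in
/-- The generating function of the Fibonacci `m`-step numbers solves
`A = X + (X + X ^ 2 + ⋯ + X ^ m) * A`. -/
theorem mk_fibm_eq (m : ℕ) :
    (mk (fibm m) : PowerSeries ℤ) =
      X + (∑ j ∈ Finset.range m, X ^ (j + 1)) * mk (fibm m) := by
  ext n
  rw [Finset.sum_mul, map_add, map_sum]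
  simp only [coeff_X_pow_mul', coeff_mk, coeff_X]
  match n with
  | 0 => simp [fibm]
  | 1 => simp [fibm]
  | n + 2 =>
    rw [fibm, if_neg (by omega), zero_add]
    refine Finset.sum_congr rfl fun j _ => ?_
    split_ifs with h
    · congr 1
      omega
    · rw [show n + 1 - j = 0 by omega, fibm]

open PowerSeries in
/-- The convolution identity for `fibm m` and `fibm (m + 2)` on generating functions. -/
theorem mk_fibm_add_two_sub (m : ℕ) :
    (mk (fibm (m + 2)) - mk (fibm m) : PowerSeries ℤ) =
      X ^ m * (mk (fibm m) * ((1 + X) * mk (fibm (m + 2)))) := by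
  have hA := mk_fibm_eq m
  have hB := mk_fibm_eq (m + 2)
  rw [Finset.sum_range_succ, Finset.sum_range_succ] at hB
  generalize (mk (fibm m) : PowerSeries ℤ) = A at *
  generalize (mk (fibm (m + 2)) : PowerSeries ℤ) = B at *
  refine mul_left_cancel₀ (X_ne_zero (R := ℤ)) ?_
  linear_combination A * hB - B * hA

open PowerSeries in
theorem stmt_3 (m : ℕ) (hm : 1 ≤ m) (n : ℕ) (hn : m ≤ n) :
    ∑ j ∈ Finset.range (n - m), fibm m j *
        (fibm (m + 2) (n - m - j) + fibm (m + 2) (n - m - j - 1)) =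
      fibm (m + 2) n - fibm m n := by
  have key := congrArg (coeff n) (mk_fibm_add_two_sub m)
  have hG (k : ℕ) : coeff k ((1 + X) * mk (fibm (m + 2)) : PowerSeries ℤ) =
      fibm (m + 2) k + fibm (m + 2) (k - 1) := by
    cases k <;> simp [add_mul, fibm, coeff_succ_X_mul]
  rw [coeff_X_pow_mul', if_pos hn, coeff_mul,
    Finset.Nat.sum_antidiagonal_eq_sum_range_succ_mk, Finset.sum_range_succ] at key
  simp only [hG, map_sub, coeff_mk] at key
  rw [key]
  simp [fibm]
end

section
/- For every integer n ≥ 1, ∑_{j=0}^{n} F(j) · Q(n-j) = Q(n+1) + Q(n-1) − F(n+1). -/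
theorem fibm_two_add_two (n : ℕ) : fibm 2 (n + 2) = fibm 2 (n + 1) + fibm 2 n := by
  rw [fibm]
  simp [Finset.sum_range_succ]

theorem fibm_four_add_four (n : ℕ) :
    fibm 4 (n + 4) = fibm 4 (n + 3) + fibm 4 (n + 2) + fibm 4 (n + 1) + fibm 4 n := by
  rw [fibm]
  simp [Finset.sum_range_succ]

/-- The convolution of the Fibonacci numbers with any sequence `g` satisfies the Fibonacci
recurrence with inhomogeneous term `g`. -/
theorem sum_fibm_two_mul_add_two (g : ℕ → ℤ) (n : ℕ) :
    ∑ j ∈ Finset.range (n + 3), fibm 2 j * g (n + 2 - j) =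
      ∑ j ∈ Finset.range (n + 2), fibm 2 j * g (n + 1 - j) +
        ∑ j ∈ Finset.range (n + 1), fibm 2 j * g (n - j) + g (n + 1) := by
  have h0 : fibm 2 0 = 0 := by rw [fibm]
  have h1 : fibm 2 1 = 1 := by rw [fibm]
  rw [Finset.sum_range_succ', Finset.sum_range_succ', Finset.sum_range_succ' _ (n + 1)]
  simp [h0, h1, fibm_two_add_two, add_mul, Finset.sum_add_distrib]

theorem sum_fibm_two_mul_fibm_four (k : ℕ) :
    ∑ j ∈ Finset.range (k + 2), fibm 2 j * fibm 4 (k + 1 - j) =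
      fibm 4 (k + 2) + fibm 4 k - fibm 2 (k + 2) := by
  induction k using Nat.twoStepInduction with
  | zero => simp [Finset.sum_range_succ, fibm]
  | one => simp [Finset.sum_range_succ, fibm]
  | more k ih₀ ih₁ =>
    rw [sum_fibm_two_mul_add_two (fibm 4) (k + 1), ih₀, ih₁]
    linarith [fibm_four_add_four k, fibm_two_add_two (k + 2)]

theorem stmt_6 (n : ℕ) (hn : 1 ≤ n) :
    ∑ j ∈ Finset.range (n + 1), fibm 2 j * fibm 4 (n - j) =
      fibm 4 (n + 1) + fibm 4 (n - 1) - fibm 2 (n + 1) := by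
  obtain ⟨k, rfl⟩ := Nat.exists_eq_add_of_le' hn
  exact sum_fibm_two_mul_fibm_four k
end

section
/- Let m ≥ 2 be an integer. For all integers n ≥ 2, ∑_{j=0}^{n} F^{(m-1)}(j) · F^{(m)}(n-j) = ∑_{j=0}^{n-2} 2^j · (F^{(m-1)}(n-1-j) − F^{(m)}(n-2-j)). -/
open PowerSeries in
/-- The generating function of `fibm m` is `X / (1 - X - ⋯ - X ^ m)`. -/
theorem mk_fibm_mul (m : ℕ) :
    PowerSeries.mk (fibm m) * (1 - ∑ i ∈ Finset.range m, (X : ℤ⟦X⟧) ^ (i + 1)) = X := by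
  rw [mul_sub, mul_one, sub_eq_iff_eq_add, Finset.mul_sum]
  ext n
  rw [map_add, map_sum]
  simp only [coeff_mul_X_pow', coeff_mk, coeff_X]
  match n with
  | 0 => simp [fibm]
  | 1 =>
    have h : ∀ i ∈ Finset.range m, (if i + 1 ≤ 1 then fibm m (1 - (i + 1)) else 0) = 0 := by
      intro i _
      have hi : 1 - (i + 1) = 0 := by omega
      simp [hi, fibm]
    rw [Finset.sum_eq_zero h]
    simp [fibm]
  | n + 2 =>
    rw [fibm, if_neg (by omega), zero_add]
    refine Finset.sum_congr rfl fun i _ => ?_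
    split_ifs with hi
    · congr 1
      omega
    · have h0 : n + 1 - i = 0 := by omega
      rw [h0, fibm]

open PowerSeries in
theorem one_sub_X_mul_one_sub_sum (m : ℕ) :
    (1 - X) * (1 - ∑ i ∈ Finset.range m, (X : ℤ⟦X⟧) ^ (i + 1)) = 1 - 2 * X + X ^ (m + 1) := by
  induction m with
  | zero => simp; ring
  | succ k ih =>
    rw [Finset.sum_range_succ]
    linear_combination ih

open PowerSeries in
theorem one_sub_two_X_mul_mk_fibm_mul_mk_fibm (k : ℕ) :
    (1 - 2 * X) * (PowerSeries.mk (fibm k) * PowerSeries.mk (fibm (k + 1))) =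
      X * (PowerSeries.mk (fibm k) - X * PowerSeries.mk (fibm (k + 1))) := by
  have hA := mk_fibm_mul k
  have hB := mk_fibm_mul (k + 1)
  have hP := one_sub_X_mul_one_sub_sum k
  rw [Finset.sum_range_succ] at hB
  linear_combination PowerSeries.mk (fibm k) * hB - X * PowerSeries.mk (fibm (k + 1)) * hA -
    PowerSeries.mk (fibm k) * PowerSeries.mk (fibm (k + 1)) * hP

open PowerSeries in
theorem mk_two_pow_mul_one_sub :
    PowerSeries.mk (fun n => (2 : ℤ) ^ n) * (1 - 2 * X) = 1 := by
  have h2 : (2 : ℤ⟦X⟧) = C 2 := by simp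
  ext n
  rw [mul_sub, mul_one, h2, mul_left_comm, map_sub, coeff_C_mul]
  cases n with
  | zero => simp
  | succ n => simp [coeff_succ_mul_X, coeff_one, pow_succ']

theorem stmt_10 (m : ℕ) (hm : 2 ≤ m) (n : ℕ) (hn : 2 ≤ n) :
    ∑ j ∈ Finset.range (n + 1), fibm (m - 1) j * fibm m (n - j) =
      ∑ j ∈ Finset.range (n - 1), (2 : ℤ) ^ j * (fibm (m - 1) (n - 1 - j) - fibm m (n - 2 - j)) := by
  obtain ⟨k, rfl⟩ : ∃ k, m = k + 1 := ⟨m - 1, by omega⟩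
  obtain ⟨l, rfl⟩ : ∃ l, n = l + 2 := ⟨n - 2, by omega⟩
  simp only [Nat.add_sub_cancel, show l + 2 - 1 = l + 1 by omega]
  have key : PowerSeries.mk (fibm k) * PowerSeries.mk (fibm (k + 1)) =
      PowerSeries.X * (PowerSeries.mk (fun n => (2 : ℤ) ^ n) *
        (PowerSeries.mk (fibm k) - PowerSeries.X * PowerSeries.mk (fibm (k + 1)))) := by
    linear_combination PowerSeries.mk (fun n => (2 : ℤ) ^ n) *
      one_sub_two_X_mul_mk_fibm_mul_mk_fibm k -
      PowerSeries.mk (fibm k) * PowerSeries.mk (fibm (k + 1)) * mk_two_pow_mul_one_sub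
  have hc := congrArg (PowerSeries.coeff (l + 2)) key
  rw [PowerSeries.coeff_succ_X_mul, PowerSeries.coeff_mul, PowerSeries.coeff_mul,
    Finset.Nat.sum_antidiagonal_eq_sum_range_succ_mk,
    Finset.Nat.sum_antidiagonal_eq_sum_range_succ_mk, Finset.sum_range_succ _ (l + 1)] at hc
  simp only [PowerSeries.coeff_mk, Nat.sub_self] at hc
  rw [hc]
  have h0 : PowerSeries.coeff 0
      (PowerSeries.mk (fibm k) - PowerSeries.X * PowerSeries.mk (fibm (k + 1))) = 0 := by
    simp [fibm]
  rw [h0, mul_zero, add_zero]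
  refine Finset.sum_congr rfl fun j hj => ?_
  have hj' : l + 1 - j = l - j + 1 := by
    have := Finset.mem_range.mp hj
    omega
  rw [hj', map_sub, PowerSeries.coeff_succ_X_mul, PowerSeries.coeff_mk, PowerSeries.coeff_mk]
end

section
/- Let m ≥ 1 be an integer. For all integers n ≥ 2m, ∑_{j=0}^{n-1} (−1)^{j+1} · (F^{(2m+1)}(j) − F^{(2m-1)}(j)) = (−1)^{n} · ∑_{j=0}^{n-2m} F^{(2m+1)}(j) · F^{(2m-1)}(n-2m-j). -/
/-- The generating function of the Fibonacci `k`-step numbers. -/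
noncomputable def fibmSeries (k : ℕ) : PowerSeries ℤ := PowerSeries.mk (fibm k)

theorem fibmSeries_mul (k : ℕ) :
    fibmSeries k * (1 - ∑ j ∈ Finset.range k, PowerSeries.X ^ (j + 1)) = PowerSeries.X := by
  ext n
  rw [mul_sub, mul_one, Finset.mul_sum, map_sub, map_sum]
  simp only [PowerSeries.coeff_mul_X_pow', fibmSeries, PowerSeries.coeff_mk, PowerSeries.coeff_X]
  match n with
  | 0 => simp [fibm]
  | 1 =>
    have h : ∀ j ∈ Finset.range k, (if j + 1 ≤ 1 then fibm k (1 - (j + 1)) else 0) = 0 := by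
      intro j _
      simp [fibm]
    rw [Finset.sum_eq_zero h]
    simp [fibm]
  | n + 2 =>
    have h : ∀ j ∈ Finset.range k, (if j + 1 ≤ n + 2 then fibm k (n + 2 - (j + 1)) else 0) =
        fibm k (n + 1 - j) := by
      intro j _
      split_ifs with hj
      · congr 1
        omega
      · rw [Nat.sub_eq_zero_of_le (by omega : n + 1 ≤ j), fibm]
    rw [Finset.sum_congr rfl h, fibm]
    simp

theorem X_mul_fibmSeries_sub (k : ℕ) :
    PowerSeries.X * (fibmSeries (k + 2) - fibmSeries k) =
      fibmSeries (k + 2) * fibmSeries k * PowerSeries.X ^ (k + 1) +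
        fibmSeries (k + 2) * fibmSeries k * PowerSeries.X ^ (k + 2) := by
  have h₁ := fibmSeries_mul (k + 2)
  have h₂ := fibmSeries_mul k
  rw [Finset.sum_range_succ, Finset.sum_range_succ] at h₁
  linear_combination fibmSeries k * h₁ - fibmSeries (k + 2) * h₂

/-- The convolution of the Fibonacci `k`-step and `l`-step numbers. -/
def fibmConv (k l n : ℕ) : ℤ := ∑ j ∈ Finset.range (n + 1), fibm k j * fibm l (n - j)

theorem fibmConv_zero (k l : ℕ) : fibmConv k l 0 = 0 := by
  simp [fibmConv, fibm]

theorem coeff_fibmSeries_mul (k l n : ℕ) :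
    PowerSeries.coeff n (fibmSeries k * fibmSeries l) = fibmConv k l n := by
  rw [PowerSeries.coeff_mul, Finset.Nat.sum_antidiagonal_eq_sum_range_succ_mk]
  simp [fibmConv, fibmSeries]

theorem fibm_sub_fibm (k n : ℕ) :
    fibm (k + 2) n - fibm k n =
      fibmConv (k + 2) k (n - k) + fibmConv (k + 2) k (n - (k + 1)) := by
  have h := congrArg (PowerSeries.coeff (n + 1)) (X_mul_fibmSeries_sub k)
  rw [PowerSeries.coeff_succ_X_mul, map_add, PowerSeries.coeff_mul_X_pow',
    PowerSeries.coeff_mul_X_pow', coeff_fibmSeries_mul, coeff_fibmSeries_mul] at h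
  simp only [fibmSeries, map_sub, PowerSeries.coeff_mk, Nat.add_sub_add_right] at h
  rw [h]
  congr 1
  · split_ifs with hk
    · rfl
    · rw [Nat.sub_eq_zero_of_le (by omega), fibmConv_zero]
  · split_ifs with hk
    · rfl
    · rw [Nat.sub_eq_zero_of_le (by omega), fibmConv_zero]

theorem sum_alternating_fibm_sub (k n : ℕ) :
    ∑ j ∈ Finset.range n, (-1 : ℤ) ^ (j + 1) * (fibm (k + 2) j - fibm k j) =
      (-1 : ℤ) ^ n * fibmConv (k + 2) k (n - (k + 1)) := by
  induction n with
  | zero => simp [fibmConv_zero]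
  | succ n ih =>
    rw [Finset.sum_range_succ, ih, fibm_sub_fibm, Nat.add_sub_add_right]
    ring

theorem stmt_13 (m : ℕ) (hm : 1 ≤ m) (n : ℕ) (hn : 2 * m ≤ n) :
    ∑ j ∈ Finset.range n, (-1 : ℤ) ^ (j + 1) * (fibm (2 * m + 1) j - fibm (2 * m - 1) j) =
      (-1 : ℤ) ^ n *
        ∑ j ∈ Finset.range (n - 2 * m + 1), fibm (2 * m + 1) j * fibm (2 * m - 1) (n - 2 * m - j) := by
  have h := sum_alternating_fibm_sub (2 * m - 1) n
  rw [show 2 * m - 1 + 2 = 2 * m + 1 by omega, show 2 * m - 1 + 1 = 2 * m by omega] at h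
  exact h
end
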